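/- arXiv:1908.04898 — 2 statements merged into one kernel-verified Lean document; each statement's English description precedes it below -/
import Mathlib

section
/- In the Jordan plane k⟨u,v⟩/(vu - uv - u²), fix n ≥ 2 and set xᵢ = u^{n-i} vⁱ for 0 ≤ i ≤ n. Then for all i, j with 1 ≤ i ≤ j < n, the relation xᵢ xⱼ = x_{i-1} x_{j+1} + (n-1-(j-i))·x_{i-1} x_j holds. -/
/-- The defining relation of the Jordan plane: `v * u = u * v + u ^ 2`. -/
inductive JordanRel (K : Type*) [Field K] :
    FreeAlgebra K (Fin 2) → FreeAlgebra K (Fin 2) → Prop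
  | rel : JordanRel K (FreeAlgebra.ι K 1 * FreeAlgebra.ι K 0)
      (FreeAlgebra.ι K 0 * FreeAlgebra.ι K 1 + FreeAlgebra.ι K 0 ^ 2)

/-- The Jordan plane `k⟨u,v⟩/(vu - uv - u²)`. -/
abbrev JordanPlane (K : Type*) [Field K] := RingQuot (JordanRel K)

/-- The generator `u` of the Jordan plane. -/
noncomputable def JordanPlane.u (K : Type*) [Field K] : JordanPlane K :=
  RingQuot.mkAlgHom K (JordanRel K) (FreeAlgebra.ι K 0)

/-- The generator `v` of the Jordan plane. -/
noncomputable def JordanPlane.v (K : Type*) [Field K] : JordanPlane K :=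
  RingQuot.mkAlgHom K (JordanRel K) (FreeAlgebra.ι K 1)

/-- The defining relation of the Jordan plane, read in the quotient. -/
theorem JordanPlane.v_mul_u (K : Type*) [Field K] :
    v K * u K = u K * v K + u K ^ 2 := by
  simpa only [u, v, map_mul, map_add, map_pow] using
    RingQuot.mkAlgHom_rel K (JordanRel.rel (K := K))

section Semiring

variable {R : Type*} [Semiring R] {u v : R}

theorem mul_pow_of_jordan_relation (h : v * u = u * v + u ^ 2) (m : ℕ) :
    v * u ^ m = u ^ m * v + m • u ^ (m + 1) := by
  induction m with
  | zero => simp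
  | succ m ih =>
    rw [pow_succ u m, ← mul_assoc, ih, add_mul, mul_assoc, h, smul_mul_assoc, ← pow_succ,
      mul_add, ← mul_assoc, ← pow_add, add_assoc, succ_nsmul', ← pow_succ]

theorem pow_succ_mul_pow_succ_of_jordan_relation (h : v * u = u * v + u ^ 2) (i p : ℕ) :
    v ^ (i + 1) * u ^ (p + 1) =
      u * v ^ i * u ^ p * v + (p + 1 + i) • (u * v ^ i * u ^ (p + 1)) := by
  induction i with
  | zero =>
    simpa [← pow_succ'] using mul_pow_of_jordan_relation h (p + 1)
  | succ i ih =>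
    have move (w : R) : v * (u * w) = u * (v * w) + u * (u * w) := by
      rw [← mul_assoc, h, add_mul, sq, mul_assoc, mul_assoc]
    calc v ^ (i + 1 + 1) * u ^ (p + 1)
        = v * (v ^ (i + 1) * u ^ (p + 1)) := by rw [pow_succ' v (i + 1), mul_assoc]
      _ = u * v ^ (i + 1) * u ^ p * v + (p + 1 + i) • (u * v ^ (i + 1) * u ^ (p + 1)) +
          u * (u * v ^ i * u ^ p * v + (p + 1 + i) • (u * v ^ i * u ^ (p + 1))) := by
        rw [ih]
        simp only [mul_add, mul_smul_comm, mul_assoc, move, smul_add, pow_succ' v i]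
        abel
      _ = _ := by
        rw [← ih, ← mul_assoc u, add_assoc, ← succ_nsmul, add_assoc (p + 1)]

end Semiring

/-- In the Jordan plane, with `xᵢ = u^(n-i) * v^i` for `0 ≤ i ≤ n` (`n ≥ 2`),
for all `1 ≤ i ≤ j < n` one has `xᵢ xⱼ = x_{i-1} x_{j+1} + (n-1-(j-i)) • x_{i-1} xⱼ`. -/
theorem jordan_x_relations {K : Type*} [Field K] [CharZero K] (n : ℕ) (hn : 2 ≤ n)
    (x : ℕ → JordanPlane K)
    (hx : ∀ i, i ≤ n → x i = JordanPlane.u K ^ (n - i) * JordanPlane.v K ^ i) :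
    ∀ i j : ℕ, 1 ≤ i → i ≤ j → j < n →
      x i * x j = x (i - 1) * x (j + 1) + (n - 1 - (j - i)) • (x (i - 1) * x j) := by
  intro i j hi hij hj
  obtain ⟨i, rfl⟩ := Nat.exists_eq_add_of_le' hi
  obtain ⟨p, rfl⟩ : ∃ p, n = j + (p + 1) := ⟨n - j - 1, by lia⟩
  have hp : j + (p + 1) - i = j + (p + 1) - (i + 1) + 1 := by lia
  have hc : j + (p + 1) - 1 - (j - (i + 1)) = p + 1 + i := by lia
  have hq : j + (p + 1) - (j + 1) = p := by lia
  rw [Nat.add_sub_cancel, hx (i + 1) (by lia), hx j (by lia), hx i (by lia),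
    hx (j + 1) (by lia), hc, hp, hq, Nat.add_sub_cancel_left]
  have key := pow_succ_mul_pow_succ_of_jordan_relation (JordanPlane.v_mul_u K) i p
  generalize j + (p + 1) - (i + 1) = a
  rw [mul_assoc, ← mul_assoc (_ ^ (i + 1)), key]
  simp only [mul_add, add_mul, mul_smul_comm, smul_mul_assoc, mul_assoc, pow_succ _ a,
    pow_succ' _ j]
end

section
/- In the Jordan plane k⟨u,v⟩/(vu - uv - u²), fix n ≥ 2 and set yᵢ = ((-1)ⁱ/i!)·u^{n-i} vⁱ for 0 ≤ i ≤ n. Then for all j > i (with 0 ≤ i < j ≤ n), Σ_{m=0}^{j} C(n-i, m)·y_{j-m}·yᵢ = Σ_{ℓ=0}^{i} C(n-j, ℓ)·y_{i-ℓ}·yⱼ, and in fact both sides equal ((-1)^{i+j}/(i!·j!))·u^{2n-i-j}·v^{i+j}. -/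
open PowerSeries in
/-- The binomial theorem for `1 + a X` over a possibly noncommutative ring. -/
theorem PowerSeries.coeff_one_add_C_mul_X_pow {R : Type*} [Semiring R] (a : R) (k m : ℕ) :
    coeff m ((1 + C a * X : R⟦X⟧) ^ k) = k.choose m • a ^ m := by
  induction k generalizing m with
  | zero => cases m <;> simp [coeff_one]
  | succ k ih =>
    rw [pow_succ, mul_add, mul_one, ← mul_assoc, map_add, ih]
    cases m with
    | zero => simp
    | succ m =>
      rw [coeff_succ_mul_X, coeff_mul_C, ih, Nat.choose_succ_succ, add_smul, smul_mul_assoc,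
        ← pow_succ, add_comm]

namespace JordanPlane

variable {K : Type*} [Field K]

theorem v_mul_u_s3 : v K * u K = u K * v K + u K ^ 2 := by
  simpa [u, v] using RingQuot.mkAlgHom_rel K (JordanRel.rel (K := K))

theorem v_pow_succ_mul_u (j : ℕ) :
    v K ^ (j + 1) * u K = u K * v K ^ (j + 1) + ((j : K) + 1) • (u K * v K ^ j * u K) := by
  induction j with
  | zero => simp [v_mul_u_s3, sq]
  | succ j ih =>
    have h : v K ^ (j + 1 + 1) * u K = v K * u K * v K ^ (j + 1)
        + ((j : K) + 1) • (v K * u K * (v K ^ j * u K)) := by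
      rw [pow_succ' _ (j + 1), mul_assoc, ih, mul_add, mul_smul_comm]
      simp only [mul_assoc]
    have h' : u K * v K ^ (j + 1) * u K = u K * u K * v K ^ (j + 1)
        + ((j : K) + 1) • (u K * u K * (v K ^ j * u K)) := by
      rw [mul_assoc, ih, mul_add, mul_smul_comm]
      simp only [mul_assoc]
    rw [h, v_mul_u_s3, Nat.cast_succ, add_smul ((j : K) + 1), one_smul]
    nth_rewrite 2 [h']
    simp only [add_mul, smul_add, sq, pow_succ' _ (j + 1), mul_assoc]
    simp only [pow_succ' _ j, mul_assoc]
    abel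

/-- The divided power `(-v)^j / j!`. -/
noncomputable def negVDivPow (K : Type*) [Field K] (j : ℕ) : JordanPlane K :=
  ((-1 : K) ^ j / j.factorial) • v K ^ j

theorem negVDivPow_succ_mul_u [CharZero K] (j : ℕ) :
    negVDivPow K (j + 1) * u K + u K * negVDivPow K j * u K = u K * negVDivPow K (j + 1) := by
  have h : (-1 : K) ^ (j + 1) / (j + 1).factorial * ((j : K) + 1)
      = -((-1 : K) ^ j / j.factorial) := by
    have h₁ : (j.factorial : K) ≠ 0 := by exact_mod_cast j.factorial_ne_zero
    have h₂ : (j : K) + 1 ≠ 0 := by exact_mod_cast j.succ_ne_zero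
    rw [Nat.factorial_succ]
    push_cast
    field_simp
    ring
  simp only [negVDivPow, smul_mul_assoc, mul_smul_comm]
  rw [v_pow_succ_mul_u, smul_add, smul_smul, h, neg_smul, neg_add_cancel_right]

open PowerSeries in
theorem one_add_u_mul_X_pow_mul_mk_negVDivPow [CharZero K] (a : ℕ) :
    (1 + C (u K) * X) ^ a * mk (negVDivPow K) * C (u K) ^ a
      = C (u K) ^ a * mk (negVDivPow K) := by
  have base : (1 + C (u K) * X) * mk (negVDivPow K) * C (u K)
      = C (u K) * mk (negVDivPow K) := by
    ext j
    rw [add_mul, one_mul, add_mul, mul_assoc (C (u K)), mul_assoc (C (u K)), map_add,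
      coeff_mul_C, coeff_C_mul, coeff_C_mul, coeff_mk, coeff_mul_C]
    cases j with
    | zero => simp [negVDivPow]
    | succ j =>
      rw [coeff_succ_X_mul, coeff_mk, ← mul_assoc, negVDivPow_succ_mul_u]
  have comm : Commute (1 + C (u K) * X) (C (u K)) :=
    (Commute.one_left _).add_left ((Commute.refl _).mul_left (commute_X _).symm)
  induction a with
  | zero => simp
  | succ a ih =>
    calc _ = (1 + C (u K) * X) ^ a * ((1 + C (u K) * X) * mk (negVDivPow K) * C (u K))
          * C (u K) ^ a := by
          rw [pow_succ, pow_succ' (C (u K))]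
          simp only [mul_assoc]
      _ = C (u K) * ((1 + C (u K) * X) ^ a * mk (negVDivPow K) * C (u K) ^ a) := by
          rw [base]
          simp only [← mul_assoc]
          rw [(comm.pow_left a).eq]
      _ = _ := by rw [ih, pow_succ', mul_assoc]

theorem sum_choose_smul_u_pow_mul_negVDivPow [CharZero K] (a j : ℕ) :
    ∑ m ∈ Finset.range (j + 1), a.choose m • (u K ^ m * negVDivPow K (j - m) * u K ^ a)
      = u K ^ a * negVDivPow K j := by
  have h := congrArg (PowerSeries.coeff j) (one_add_u_mul_X_pow_mul_mk_negVDivPow (K := K) a)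
  rw [← map_pow, PowerSeries.coeff_mul_C, PowerSeries.coeff_C_mul, PowerSeries.coeff_mul,
    PowerSeries.coeff_mk, Finset.Nat.sum_antidiagonal_eq_sum_range_succ_mk, Finset.sum_mul] at h
  simpa [PowerSeries.coeff_one_add_C_mul_X_pow, smul_mul_assoc, mul_assoc] using h

theorem sum_choose_smul_mul [CharZero K] {n i j : ℕ} {y : ℕ → JordanPlane K}
    (hy : ∀ i, i ≤ n → y i = ((-1 : K) ^ i / i.factorial) • (u K ^ (n - i) * v K ^ i))
    (hi : i ≤ n) (hj : j ≤ n) :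
    ∑ m ∈ Finset.range (j + 1), (n - i).choose m • (y (j - m) * y i)
      = ((-1 : K) ^ (i + j) / (i.factorial * j.factorial)) •
          (u K ^ (2 * n - i - j) * v K ^ (i + j)) := by
  have hy' : ∀ k ≤ n, y k = u K ^ (n - k) * negVDivPow K k := fun k hk => by
    rw [hy k hk, negVDivPow, mul_smul_comm]
  calc _ = u K ^ (n - j) * (∑ m ∈ Finset.range (j + 1), (n - i).choose m •
          (u K ^ m * negVDivPow K (j - m) * u K ^ (n - i))) * negVDivPow K i := by
        rw [Finset.mul_sum, Finset.sum_mul]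
        refine Finset.sum_congr rfl fun m hm => ?_
        have hm' : m ≤ j := Nat.lt_succ_iff.mp (Finset.mem_range.mp hm)
        rw [hy' _ hi, hy' _ ((Nat.sub_le j m).trans hj),
          show n - (j - m) = n - j + m by omega, pow_add, mul_smul_comm, smul_mul_assoc]
        simp only [mul_assoc]
    _ = _ := by
        rw [sum_choose_smul_u_pow_mul_negVDivPow, negVDivPow, negVDivPow,
          show 2 * n - i - j = (n - j) + (n - i) by omega, add_comm i j, pow_add (u K),
          pow_add (v K), pow_add (-1 : K)]
        simp only [mul_smul_comm, smul_mul_assoc, smul_smul, mul_assoc]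
        congr 1
        rw [div_mul_div_comm, mul_comm ((-1 : K) ^ i)]

end JordanPlane

/-- In the Jordan plane, with `yᵢ = ((-1)^i / i!) • u^(n-i) * v^i` for `0 ≤ i ≤ n` (`n ≥ 2`),
for all `0 ≤ i < j ≤ n`:
`∑_{m=0}^{j} C(n-i,m) • y_{j-m} y_i = ∑_{ℓ=0}^{i} C(n-j,ℓ) • y_{i-ℓ} y_j`, and both sides
equal `((-1)^(i+j) / (i! j!)) • u^(2n-i-j) * v^(i+j)`. -/
theorem jordan_y_relations {K : Type*} [Field K] [CharZero K] (n : ℕ) (hn : 2 ≤ n)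
    (y : ℕ → JordanPlane K)
    (hy : ∀ i, i ≤ n →
      y i = (((-1 : K) ^ i / i.factorial)) • (JordanPlane.u K ^ (n - i) * JordanPlane.v K ^ i)) :
    ∀ i j : ℕ, i < j → j ≤ n →
      (∑ m ∈ Finset.range (j + 1), ((n - i).choose m) • (y (j - m) * y i)) =
        (∑ l ∈ Finset.range (i + 1), ((n - j).choose l) • (y (i - l) * y j)) ∧
      (∑ m ∈ Finset.range (j + 1), ((n - i).choose m) • (y (j - m) * y i)) =
        (((-1 : K) ^ (i + j) / (i.factorial * j.factorial)) •
          (JordanPlane.u K ^ (2 * n - i - j) * JordanPlane.v K ^ (i + j))) := by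
  intro i j hij hj
  have hi : i ≤ n := hij.le.trans hj
  have h := JordanPlane.sum_choose_smul_mul hy hi hj
  refine ⟨?_, h⟩
  rw [h, JordanPlane.sum_choose_smul_mul hy hj hi, add_comm j i, Nat.sub_right_comm,
    mul_comm (j.factorial : K)]
end
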